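/- Tight GFG co-Büchi automata are weak-type: if A = (Σ, Q, Q₀, δ, α) is a tight GFG co-Büchi automaton such that L(A) is recognized by some GFG weak automaton, then there exists α' ⊆ Q such that the automaton A' = (Σ, Q, Q₀, δ, α') is a weak automaton that is GFG and equivalent to A. -/

import Mathlib

namespace GFG

/-- The structure of a nondeterministic automaton on infinite words:
alphabet `A`, states `Q`, initial states and transition function.
The acceptance condition is kept separate, as a predicate on the set
of states visited infinitely often. -/
structure Auto (A Q : Type) where
  init : Set Q
  next : Q → A → Set Q

variable {A Q Mem : Type}

/-- `r` is a run of the automaton `M` on the infinite word `w`. -/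
def Auto.IsRun (M : Auto A Q) (w : ℕ → A) (r : ℕ → Q) : Prop :=
  r 0 ∈ M.init ∧ ∀ i, r (i + 1) ∈ M.next (r i) (w i)

/-- The set of states occurring infinitely often in `r`. -/
def InfOcc (r : ℕ → Q) : Set Q := {q | ∀ n, ∃ m, n ≤ m ∧ r m = q}

/-- The language of `M` with acceptance condition `acc` (a predicate on `inf(r)`). -/
def Auto.Lang (M : Auto A Q) (acc : Set Q → Prop) : Set (ℕ → A) :=
  {w | ∃ r, M.IsRun w r ∧ acc (InfOcc r)}

/-- `M` is deterministic: one initial state and at most one successor per state/letter. -/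
def Auto.IsDet (M : Auto A Q) : Prop :=
  (∃ q0, M.init = {q0}) ∧ ∀ q a, (M.next q a).Subsingleton

/-- `A^q`: the automaton `M` with set of initial states `{q}`. -/
def Auto.withInit (M : Auto A Q) (q : Q) : Auto A Q := ⟨{q}, M.next⟩

/-- Büchi condition: `inf(r) ∩ α ≠ ∅`. -/
def BuchiAcc (α : Set Q) (S : Set Q) : Prop := (S ∩ α).Nonempty

/-- co-Büchi condition: `inf(r) ∩ α = ∅`. -/
def CoBuchiAcc (α : Set Q) (S : Set Q) : Prop := S ∩ α = ∅

/-- Rabin condition with bad sets `E i` and good sets `F i`. -/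
def RabinAcc {ι : Type} (E F : ι → Set Q) (S : Set Q) : Prop :=
  ∃ i, S ∩ E i = ∅ ∧ (S ∩ F i).Nonempty

/-- Streett condition with pairs `(E i, F i)`. -/
def StreettAcc {ι : Type} (E F : ι → Set Q) (S : Set Q) : Prop :=
  ∀ i, S ∩ E i = ∅ ∨ (S ∩ F i).Nonempty

/-- Parity condition: the minimal priority seen infinitely often is even. -/
def ParityAcc (c : Q → ℕ) (S : Set Q) : Prop := Even (sInf (c '' S))

/-- The prefix of length `n` of the infinite word `w`, as a list. -/
def prefixWord (w : ℕ → A) (n : ℕ) : List A := (List.range n).map w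

/-- The run induced by a strategy `g : A* → Q` on the word `w`:
`g(ε), g(a₁), g(a₁a₂), …`. -/
def StrategyRun (g : List A → Q) (w : ℕ → A) : ℕ → Q := fun n => g (prefixWord w n)

/-- `g` witnesses GFGness of `M` (with acceptance `acc`): for every word `w` the
induced sequence is a run of `M` on `w`, accepting whenever `w ∈ L(M)`. -/
def IsGFGStrategy (M : Auto A Q) (acc : Set Q → Prop) (g : List A → Q) : Prop :=
  ∀ w : ℕ → A, M.IsRun w (StrategyRun g w) ∧
    (w ∈ M.Lang acc → acc (InfOcc (StrategyRun g w)))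

/-- `M` is good for games. -/
def IsGFG (M : Auto A Q) (acc : Set Q → Prop) : Prop :=
  ∃ g : List A → Q, IsGFGStrategy M acc g

/-- `M` is unambiguous: every word of the language has exactly one accepting run. -/
def Unambiguous (M : Auto A Q) (acc : Set Q → Prop) : Prop :=
  ∀ w ∈ M.Lang acc, ∃! r : ℕ → Q, M.IsRun w r ∧ acc (InfOcc r)

/-- `M` is determinizable by pruning. -/
def DetByP (M : Auto A Q) (acc : Set Q → Prop) : Prop :=
  ∃ q0 ∈ M.init, ∃ next' : Q → A → Set Q,
    (∀ q a, next' q a ⊆ M.next q a ∧ (next' q a).Subsingleton) ∧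
    (⟨{q0}, next'⟩ : Auto A Q).Lang acc = M.Lang acc

/-- A finite-state strategy (transducer): memories `Mem`, initial memory `m0`,
memory update function `upd` and output function `out`. -/
structure Transducer (A Q Mem : Type) where
  m0 : Mem
  upd : Mem → A → Mem
  out : Mem → Q

namespace Transducer

variable (T : Transducer A Q Mem)

/-- The memory reached from `m` after reading the finite word `u`. -/
def run (m : Mem) (u : List A) : Mem := u.foldl T.upd m

/-- The strategy generated by the transducer: `u ↦ τ(ρ(m₀, u))`. -/
def strategy : List A → Q := fun u => T.out (T.run T.m0 u)

/-- The deterministic automaton `A_g`, with initial memory replaced by `m`. -/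
def autoFrom (m : Mem) : Auto A Mem := ⟨{m}, fun m' a => {T.upd m' a}⟩

/-- The deterministic automaton `A_g` itself. -/
def auto : Auto A Mem := T.autoFrom T.m0

/-- The acceptance condition `α_g` of `A_g`, obtained from `acc` by replacing each
set `F ⊆ Q` appearing in it by `{m | τ(m) ∈ F}`. -/
def accG (acc : Set Q → Prop) : Set Mem → Prop := fun S => acc (T.out '' S)

/-- `m` is reachable in `A_g` from the initial memory. -/
def Reachable (m : Mem) : Prop := ∃ u : List A, T.run T.m0 u = m

/-- The set of memories visited along the path of `A_g` that starts at `m` and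
reads the finite word `u` (both endpoints included). -/
def pathStates (m : Mem) (u : List A) : Set Mem :=
  {m' | ∃ v : List A, v <+: u ∧ T.run m v = m'}

/-- `P_{src → dst}`: the (words inducing the) finite paths of `A_g` from `src` to `dst`. -/
def PathSet (src dst : Mem) : Set (List A) :=
  {u : List A | u ≠ [] ∧ T.run src u = dst}

/-- Every combination of paths from `P_{src → dst}` satisfies `α_g`. -/
def AllCombosAcc (acc : Set Q → Prop) (src dst : Mem) : Prop :=
  ∀ S : Set (List A), S.Nonempty → S ⊆ T.PathSet src dst →
    T.accG acc (⋃ u ∈ S, T.pathStates src u)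

/-- `P_{src → dst}` is empty, or every combination of its paths satisfies `α_g`. -/
def GoodPathSet (acc : Set Q → Prop) (src dst : Mem) : Prop :=
  T.PathSet src dst = ∅ ∨ T.AllCombosAcc acc src dst

/-- `m` is replaceable by `m'`: the set `P_{m' → m}` of paths of `A_g` from `m'`
to `m` is empty, or every combination of its paths satisfies `α_g`. -/
def Replaceable (acc : Set Q → Prop) (m m' : Mem) : Prop :=
  T.GoodPathSet acc m' m

/-- The transition `(q, a, q')` is used by the strategy. -/
def Uses (q : Q) (a : A) (q' : Q) : Prop :=
  ∃ u : List A, T.strategy u = q ∧ T.strategy (u ++ [a]) = q'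

/-- The nonempty word `u` induces a cycle of `A_g` through the memory `m`. -/
def CycleThrough (m : Mem) (u : List A) : Prop := u ≠ [] ∧ T.run m u = m

/-- The cycle of `A_g` through `m` induced by `u` is accepting. -/
def AccCycle (acc : Set Q → Prop) (m : Mem) (u : List A) : Prop :=
  T.CycleThrough m u ∧ T.accG acc (T.pathStates m u)

/-- The cycle of `A_g` through `m` induced by `u` is rejecting. -/
def RejCycle (acc : Set Q → Prop) (m : Mem) (u : List A) : Prop :=
  T.CycleThrough m u ∧ ¬ T.accG acc (T.pathStates m u)

/-- The cycle of `A_g` through `m` induced by `u` is `q`-exclusive accepting: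
it is accepting, but its set of memories minus the memories of `q` is not. -/
def ExclAccCycle (acc : Set Q → Prop) (q : Q) (m : Mem) (u : List A) : Prop :=
  T.CycleThrough m u ∧ T.accG acc (T.pathStates m u) ∧
    ¬ T.accG acc (T.pathStates m u \ {m' : Mem | T.out m' = q})

end Transducer

/-- `M` is weakly tight with respect to `T`: every transition of `M` is used. -/
def WeaklyTightWrt (M : Auto A Q) (T : Transducer A Q Mem) : Prop :=
  ∀ q a q', q' ∈ M.next q a → T.Uses q a q'

/-- `M` is tight with respect to `T`: every transition of `M` is used, and no memory
is replaceable by a different memory of the same state. -/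
def TightWrt (M : Auto A Q) (acc : Set Q → Prop) (T : Transducer A Q Mem) : Prop :=
  WeaklyTightWrt M T ∧
  ∀ m m' : Mem, m ≠ m' → T.out m = T.out m' → ¬ T.Replaceable acc m m'

/-- `M` is tight: tight with respect to some finite-state strategy witnessing its GFGness. -/
def Tight (M : Auto A Q) (acc : Set Q → Prop) : Prop :=
  ∃ (Mem : Type) (_ : Fintype Mem) (T : Transducer A Q Mem),
    IsGFGStrategy M acc T.strategy ∧ TightWrt M acc T

/-- `M` is weakly tight: weakly tight with respect to some finite-state strategy
witnessing its GFGness. -/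
def WeaklyTight (M : Auto A Q) (acc : Set Q → Prop) : Prop :=
  ∃ (Mem : Type) (_ : Fintype Mem) (T : Transducer A Q Mem),
    IsGFGStrategy M acc T.strategy ∧ WeaklyTightWrt M T

/-- A Rabin automaton `M` (with pairs `(E i, F i)`) is strongly tight with respect to `T`:
tight, and every state appearing in some good set has a `q`-exclusive accepting cycle
in `A_g`. -/
def StronglyTightWrt {ι : Type} (M : Auto A Q) (E F : ι → Set Q)
    (T : Transducer A Q Mem) : Prop :=
  TightWrt M (RabinAcc E F) T ∧
  ∀ q : Q, (∃ i, q ∈ F i) →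
    ∃ (m : Mem) (u : List A), T.ExclAccCycle (RabinAcc E F) q m u

/-- A Rabin automaton is strongly tight: strongly tight with respect to some finite-state
strategy witnessing its GFGness. -/
def StronglyTight {ι : Type} (M : Auto A Q) (E F : ι → Set Q) : Prop :=
  ∃ (Mem : Type) (_ : Fintype Mem) (T : Transducer A Q Mem),
    IsGFGStrategy M (RabinAcc E F) T.strategy ∧ StronglyTightWrt M E F T

/-- One-step reachability in the transition graph of `M`. -/
def Auto.Step (M : Auto A Q) (q q' : Q) : Prop := ∃ a, q' ∈ M.next q a

/-- Reachability in the transition graph of `M`. -/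
def Auto.Reach (M : Auto A Q) : Q → Q → Prop := Relation.ReflTransGen M.Step

/-- The Büchi automaton `(M, α)` is weak: each strongly connected component is either
contained in `α` or disjoint from `α`. -/
def Auto.IsWeak (M : Auto A Q) (α : Set Q) : Prop :=
  ∀ q q', M.Reach q q' → M.Reach q' q → (q ∈ α ↔ q' ∈ α)

theorem prefixWord_succ (w : ℕ → A) (n : ℕ) :
    prefixWord w (n + 1) = prefixWord w n ++ [w n] := by
  simp [prefixWord, List.range_succ]

theorem Transducer.run_append (T : Transducer A Q Mem) (m : Mem) (u v : List A) :
    T.run m (u ++ v) = T.run (T.run m u) v := by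
  simp [Transducer.run]

theorem prefixWord_length (w : ℕ → A) (n : ℕ) : (prefixWord w n).length = n := by
  simp [prefixWord]

/-- the word `v x^ω` -/
theorem exists_periodic (T : Transducer A Q Mem) (m : Mem) (v x : List A)
    (hv : T.run T.m0 v = m) (hx : x ≠ []) (hm : T.run m x = m) :
    ∃ w : ℕ → A, prefixWord w v.length = v ∧
      ∀ j, T.run T.m0 (prefixWord w (v.length + j)) = T.run m (x.take (j % x.length)) := by
  have hl : 0 < x.length := List.length_pos_of_ne_nil hx
  let w : ℕ → A := fun n => if h : n < v.length then v[n] else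
    x[(n - v.length) % x.length]'(Nat.mod_lt _ hl)
  have h1 : prefixWord w v.length = v := by
    apply List.ext_getElem
    · simp [prefixWord]
    · intro i h1 h2
      simp [prefixWord, w, h2]
  refine ⟨w, h1, ?_⟩
  intro j
  induction j with
  | zero => rw [Nat.add_zero, h1, hv]; simp [Transducer.run]
  | succ j ih =>
    rw [← Nat.add_assoc, prefixWord_succ, Transducer.run_append, ih]
    have hw : w (v.length + j) = x[j % x.length]'(Nat.mod_lt _ hl) := by
      simp [w]
    rw [hw, ← Transducer.run_append, List.take_append_getElem]
    by_cases h : j % x.length + 1 = x.length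
    · have h2 : (j + 1) % x.length = 0 := by
        rw [Nat.add_mod_eq_add_mod_right 1 (Nat.mod_mod j x.length).symm, h, Nat.mod_self]
      rw [h, h2, List.take_length, hm]
      simp [Transducer.run]
    · have h2 : (j + 1) % x.length = j % x.length + 1 := by
        have h3 := Nat.mod_lt j hl
        rw [Nat.add_mod_eq_add_mod_right 1 (Nat.mod_mod j x.length).symm]
        exact Nat.mod_eq_of_lt (by omega)
      rw [h2]

theorem reach_of_le (M : Auto A Q) (r : ℕ → Q) (hr : ∀ n, M.Step (r n) (r (n + 1)))
    {i j : ℕ} (hij : i ≤ j) : M.Reach (r i) (r j) := by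
  induction j, hij using Nat.le_induction with
  | base => exact Relation.ReflTransGen.refl
  | succ n _ ih => exact ih.tail (hr n)

theorem exists_stable [Finite Q] (M : Auto A Q) (r : ℕ → Q)
    (hr : ∀ n, M.Step (r n) (r (n + 1))) :
    ∃ N, ∀ n, N ≤ n → M.Reach (r n) (r N) := by
  let f : ℕ → ℕ := fun n => {q | M.Reach (r n) q}.ncard
  obtain ⟨N, hN⟩ : ∃ N, ∀ n, f N ≤ f n := ⟨Function.argmin f, fun n => Function.argmin_le f n⟩
  refine ⟨N, fun n hn => ?_⟩
  have hsub : {q | M.Reach (r n) q} ⊆ {q | M.Reach (r N) q} := fun q hq =>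
    Relation.ReflTransGen.trans (reach_of_le M r hr hn) hq
  have := Set.eq_of_subset_of_ncard_le hsub (hN n) (Set.toFinite _)
  have h2 : r N ∈ {q | M.Reach (r N) q} := Relation.ReflTransGen.refl
  rw [← this] at h2
  exact h2

theorem eventually_infOcc [Finite Q] (r : ℕ → Q) : ∃ N, ∀ n, N ≤ n → r n ∈ InfOcc r := by
  have : ∀ q, ∃ N, ∀ n, N ≤ n → r n = q → q ∈ InfOcc r := by
    intro q
    by_cases h : q ∈ InfOcc r
    · exact ⟨0, fun _ _ _ => h⟩
    · simp only [InfOcc, Set.mem_ofPred_eq, not_forall, not_exists, not_and] at h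
      obtain ⟨N, hN⟩ := h
      exact ⟨N, fun n hn e => absurd e (hN n hn)⟩
  choose N hN using this
  obtain ⟨B, hB⟩ := (Set.finite_range N).bddAbove
  exact ⟨B, fun n hn => hN (r n) n ((hB ⟨r n, rfl⟩).trans hn) rfl⟩

/-- In a weak automaton, Büchi acceptance is decided in the limit. -/
theorem weak_limit [Finite Q] (M : Auto A Q) (β : Set Q) (hW : M.IsWeak β) (r : ℕ → Q)
    (hr : ∀ n, M.Step (r n) (r (n + 1))) :
    ∃ N, ∀ n, N ≤ n → (r n ∈ β ↔ BuchiAcc β (InfOcc r)) := by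
  obtain ⟨N, hN⟩ := exists_stable M r hr
  obtain ⟨K, hK⟩ := eventually_infOcc r
  have key : ∀ n, N ≤ n → (r n ∈ β ↔ r N ∈ β) := fun n hn =>
    hW _ _ (hN n hn) (reach_of_le M r hr hn)
  refine ⟨N, fun n hn => ?_⟩
  rw [key n hn]
  constructor
  · intro h
    exact ⟨r (max N K), hK _ (le_max_right _ _), (key _ (le_max_left _ _)).2 h⟩
  · rintro ⟨q, hq, hb⟩
    obtain ⟨k, hk, rfl⟩ := hq N
    exact (key k hk).1 hb

theorem no_mixed {Q' : Type} [Finite Q'] (M : Auto A Q) (α : Set Q) (T : Transducer A Q Mem)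
    (hT : IsGFGStrategy M (CoBuchiAcc α) T.strategy)
    (W : Auto A Q') (β : Set Q') (hW : W.IsWeak β) (h : List A → Q')
    (hh : IsGFGStrategy W (BuchiAcc β) h)
    (hL : W.Lang (BuchiAcc β) = M.Lang (CoBuchiAcc α))
    (m : Mem) (v0 : List A) (hv0 : T.run T.m0 v0 = m)
    (x : List A) (hx : x ≠ []) (hxm : T.run m x = m)
    (hxa : ∀ i, i < x.length → T.out (T.run m (x.take i)) ∉ α)
    (y : List A) (hy : y ≠ []) (hym : T.run m y = m)
    (i : ℕ) (hi : i < y.length) (hya : T.out (T.run m (y.take i)) ∈ α) : False := by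
  have hstep : ∀ w n, W.Step (StrategyRun h w n) (StrategyRun h w (n + 1)) := fun w n =>
    ⟨w n, (hh w).1.2 n⟩
  have hacc : ∀ w, w ∈ M.Lang (CoBuchiAcc α) ↔ BuchiAcc β (InfOcc (StrategyRun h w)) := by
    intro w
    rw [← hL]
    exact ⟨(hh w).2, fun h' => ⟨_, (hh w).1, h'⟩⟩
  -- going to `β`
  have goX : ∀ v, T.run T.m0 v = m → ∃ v', T.run T.m0 v' = m ∧ W.Reach (h v) (h v') ∧
      h v' ∈ β := by
    intro v hv
    obtain ⟨w, hw1, hw2⟩ := exists_periodic T m v x hv hx hxm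
    have hl : 0 < x.length := List.length_pos_of_ne_nil hx
    obtain ⟨N, hN⟩ := weak_limit W β hW _ (hstep w)
    have hb : BuchiAcc β (InfOcc (StrategyRun h w)) := by
      rw [← hacc]
      refine ⟨_, (hT w).1, ?_⟩
      rw [CoBuchiAcc, Set.eq_empty_iff_forall_notMem]
      rintro q ⟨hq, hqa⟩
      obtain ⟨k, hk, rfl⟩ := hq v.length
      obtain ⟨j, rfl⟩ := Nat.exists_eq_add_of_le hk
      simp only [StrategyRun, Transducer.strategy, hw2] at hqa
      exact hxa _ (Nat.mod_lt _ hl) hqa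
    refine ⟨prefixWord w (v.length + N * x.length), ?_, ?_, ?_⟩
    · rw [hw2]; simp [Transducer.run]
    · have := reach_of_le W _ (hstep w) (Nat.le_add_right v.length (N * x.length))
      simpa only [StrategyRun, hw1] using this
    · exact (hN _ (by nlinarith)).2 hb
  have goY : ∀ v, T.run T.m0 v = m → ∃ v', T.run T.m0 v' = m ∧ W.Reach (h v) (h v') ∧
      h v' ∉ β := by
    intro v hv
    obtain ⟨w, hw1, hw2⟩ := exists_periodic T m v y hv hy hym
    have hl : 0 < y.length := List.length_pos_of_ne_nil hy
    obtain ⟨N, hN⟩ := weak_limit W β hW _ (hstep w)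
    have hb : ¬ BuchiAcc β (InfOcc (StrategyRun h w)) := by
      rw [← hacc]
      intro hmem
      have hc := (hT w).2 hmem
      rw [CoBuchiAcc, Set.eq_empty_iff_forall_notMem] at hc
      refine hc _ ⟨?_, hya⟩
      intro n
      refine ⟨v.length + (i + y.length * n), by nlinarith, ?_⟩
      simp only [StrategyRun, Transducer.strategy, hw2]
      rw [Nat.add_mul_mod_self_left, Nat.mod_eq_of_lt hi]
    refine ⟨prefixWord w (v.length + N * y.length), ?_, ?_, ?_⟩
    · rw [hw2]; simp [Transducer.run]
    · have := reach_of_le W _ (hstep w) (Nat.le_add_right v.length (N * y.length))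
      simpa only [StrategyRun, hw1] using this
    · exact fun hc => hb ((hN _ (by nlinarith)).1 hc)
  have main : ∀ n v, T.run T.m0 v = m → h v ∈ β → {q | W.Reach (h v) q}.ncard = n → False := by
    intro n
    induction n using Nat.strong_induction_on with
    | _ n ih =>
      intro v hv hb hn
      obtain ⟨v1, hv1, hr1, hb1⟩ := goY v hv
      obtain ⟨v2, hv2, hr2, hb2⟩ := goX v1 hv1
      refine ih _ ?_ v2 hv2 hb2 rfl
      rw [← hn]
      apply Set.ncard_lt_ncard _ (Set.toFinite _)
      refine ⟨fun q hq => (hr1.trans hr2).trans hq, fun hsub => ?_⟩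
      have hback : W.Reach (h v2) (h v) := hsub Relation.ReflTransGen.refl
      exact hb1 ((hW _ _ hr1 (hr2.trans hback)).1 hb)
  obtain ⟨v, hv, -, hb⟩ := goX v0 hv0
  exact main _ v hv hb rfl

/-- Lifting of paths from the automaton to the transducer. -/
theorem lift_reach (M : Auto A Q) (α : Set Q) (T : Transducer A Q Mem)
    (ht : TightWrt M (CoBuchiAcc α) T) (m : Mem) (q : Q) (h : M.Reach (T.out m) q) :
    ∃ u, T.out (T.run m u) = q := by
  induction h with
  | refl => exact ⟨[], rfl⟩
  | @tail b c _ hstep ih =>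
    obtain ⟨u, hu⟩ := ih
    obtain ⟨a, ha⟩ := hstep
    obtain ⟨z, hz1, hz2⟩ := ht.1 _ _ _ ha
    have hsame : ∃ t, T.run (T.run m u) t = T.run T.m0 z := by
      by_cases he : T.run T.m0 z = T.run m u
      · exact ⟨[], he.symm⟩
      · have h1 := ht.2 _ _ he (by rw [hu]; exact hz1)
        simp only [Transducer.Replaceable, Transducer.GoodPathSet, not_or] at h1
        obtain ⟨t, ht'⟩ := Set.nonempty_iff_ne_empty.2 h1.1
        exact ⟨t, ht'.2⟩
    obtain ⟨t, ht'⟩ := hsame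
    refine ⟨u ++ (t ++ [a]), ?_⟩
    rw [T.run_append, T.run_append, ht', ← T.run_append]
    exact hz2

theorem lift_same (M : Auto A Q) (α : Set Q) (T : Transducer A Q Mem)
    (ht : TightWrt M (CoBuchiAcc α) T) (m m' : Mem) (h : T.out m = T.out m') :
    ∃ u, T.run m u = m' := by
  by_cases he : m' = m
  · exact ⟨[], he.symm⟩
  · have h1 := ht.2 _ _ he h.symm
    simp only [Transducer.Replaceable, Transducer.GoodPathSet, not_or] at h1
    obtain ⟨t, ht'⟩ := Set.nonempty_iff_ne_empty.2 h1.1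
    exact ⟨t, ht'.2⟩

/-- Tight GFG co-Büchi automata are weak-type: a tight GFG co-Büchi
automaton whose language is GFG-weak-realizable has an equivalent GFG weak automaton
on the same structure. -/
theorem stmt16 {A Q : Type} [Fintype A] [Fintype Q]
    (M : Auto A Q) (α : Set Q)
    (htight : Tight M (CoBuchiAcc α))
    (hreal : ∃ (Q' : Type) (_ : Fintype Q') (W : Auto A Q') (β : Set Q'),
      W.IsWeak β ∧ IsGFG W (BuchiAcc β) ∧
      W.Lang (BuchiAcc β) = M.Lang (CoBuchiAcc α)) :
    ∃ α' : Set Q, M.IsWeak α' ∧ IsGFG M (BuchiAcc α') ∧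
      M.Lang (BuchiAcc α') = M.Lang (CoBuchiAcc α) := by
  obtain ⟨Mem, _, T, hT, ht⟩ := htight
  obtain ⟨Q', _, W, β, hW, ⟨h, hh⟩, hL⟩ := hreal
  let α' : Set Q := {q | ∀ q', M.Reach q q' → M.Reach q' q → q' ∉ α}
  have hweak : M.IsWeak α' := by
    intro q q' h1 h2
    constructor
    · intro hq p hp1 hp2
      exact hq p (h1.trans hp1) (hp2.trans h2)
    · intro hq p hp1 hp2
      exact hq p (h2.trans hp1) (hp2.trans h1)
  have hsub : M.Lang (BuchiAcc α') ⊆ M.Lang (CoBuchiAcc α) := by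
    rintro w ⟨r, hr, hacc⟩
    refine ⟨r, hr, ?_⟩
    obtain ⟨N, hN⟩ := weak_limit M α' hweak r (fun n => ⟨w n, hr.2 n⟩)
    rw [CoBuchiAcc, Set.eq_empty_iff_forall_notMem]
    rintro q ⟨hq, hqa⟩
    obtain ⟨k, hk, rfl⟩ := hq N
    exact (hN k hk).2 hacc _ Relation.ReflTransGen.refl Relation.ReflTransGen.refl hqa
  have hstrat : ∀ w, w ∈ M.Lang (CoBuchiAcc α) →
      BuchiAcc α' (InfOcc (StrategyRun T.strategy w)) := by
    intro w hw
    have hacc := (hT w).2 hw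
    rw [CoBuchiAcc, Set.eq_empty_iff_forall_notMem] at hacc
    obtain ⟨N, hN⟩ := eventually_infOcc (StrategyRun T.strategy w)
    have hNa : ∀ n, N ≤ n → T.out (T.run T.m0 (prefixWord w n)) ∉ α := fun n hn hc =>
      hacc _ ⟨hN n hn, hc⟩
    obtain ⟨K, hK⟩ := eventually_infOcc (fun n => T.run T.m0 (prefixWord w n))
    let I := max N K
    let m := T.run T.m0 (prefixWord w I)
    have hIN : N ≤ I := le_max_left _ _
    obtain ⟨J, hJ, hJm⟩ := hK I (le_max_right _ _) (I + 1)
    refine ⟨T.out m, hN I hIN, ?_⟩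
    intro q' h1 h2 hqa
    obtain ⟨u, hu⟩ := lift_reach M α T ht m q' h1
    rw [← hu] at h2 hqa
    obtain ⟨u2, hu2⟩ := lift_reach M α T ht _ _ h2
    obtain ⟨u3, hu3⟩ := lift_same M α T ht _ _ hu2
    have hpre : ∀ i, prefixWord w (I + i) =
        prefixWord w I ++ (List.range i).map (fun k => w (I + k)) := by
      intro i
      simp [prefixWord, List.range_add, Function.comp_def]
    have hcyc : T.run m (u ++ (u2 ++ u3)) = m := by
      rw [T.run_append, T.run_append, hu3]
    have hmα : T.out m ∉ α := hNa I hIN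
    have hune : u2 ++ u3 ≠ [] := by
      intro h0
      rw [h0, List.append_nil] at hcyc
      rw [hcyc] at hqa
      exact hmα hqa
    obtain ⟨d, rfl⟩ := Nat.exists_eq_add_of_le hJ
    have hxm : T.run m ((List.range (1 + d)).map (fun k => w (I + k))) = m := by
      rw [← T.run_append, ← hpre, ← Nat.add_assoc]
      exact hJm
    refine no_mixed M α T hT W β hW h hh hL m (prefixWord w I) rfl
      ((List.range (1 + d)).map (fun k => w (I + k))) (by simp) hxm ?_
      (u ++ (u2 ++ u3)) (by simp [hune]) hcyc u.length ?_ ?_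
    · intro i hi
      have hi' : i < 1 + d := by simpa using hi
      rw [← List.map_take, List.take_range, min_eq_left hi'.le, ← T.run_append, ← hpre]
      exact hNa _ (by omega)
    · have := List.length_pos_of_ne_nil hune
      rw [List.length_append]; omega
    · rw [List.take_left]; exact hqa
  refine ⟨α', hweak, ⟨T.strategy, fun w => ⟨(hT w).1, fun hw => hstrat w (hsub hw)⟩⟩, ?_⟩
  exact Set.Subset.antisymm hsub (fun w hw => ⟨_, (hT w).1, hstrat w hw⟩)

end GFG
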